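/- arXiv:math/0405477 — 2 statements merged into one kernel-verified Lean document; each statement's English description precedes it below -/
import Mathlib

section
/- In R = U[[h]] (Jordanian deformation of sl(3)): [T⁻¹E₁,F₁] = (1/2)(T+T⁻¹)H₁ + (1/2)(T-T⁻¹)H₂, [T⁻¹E₂,F₂] = (1/2)(T+T⁻¹)H₂ + (1/2)(T-T⁻¹)H₁, and [T⁻¹E₁,F₂] = [T⁻¹E₂,F₁] = 0 (all brackets are commutators [a,b]=ab-ba). -/
noncomputable section

open LieAlgebra.SpecialLinear

attribute [local instance 100] LieRing.ofAssociativeRing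

/-- The generalized binomial coefficient `α(α-1)⋯(α-n+1)/n!`. -/
def qbinom (α : ℚ) (n : ℕ) : ℚ :=
  (∏ i ∈ Finset.range n, (α - (i : ℚ))) / (n.factorial : ℚ)

/-- `U(sl(3,ℂ))`, the universal enveloping algebra of `sl(3,ℂ)`. -/
abbrev Usl3 : Type := UniversalEnvelopingAlgebra ℂ (sl (Fin 3) ℂ)

namespace Usl3

/-- The canonical embedding `sl(3,ℂ) → U(sl(3,ℂ))`. -/
def ι : sl (Fin 3) ℂ →ₗ⁅ℂ⁆ Usl3 := UniversalEnvelopingAlgebra.ι ℂ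

/-- `h₁`, the image of the matrix `E₁₁ - E₂₂`. -/
def h₁ : Usl3 := ι ⟨Matrix.single 0 0 1 - Matrix.single 1 1 1,
  show _ ∈ LinearMap.ker (Matrix.traceLinearMap (Fin 3) ℂ ℂ) by
    simp [LinearMap.mem_ker, Matrix.trace_single_eq_same]⟩

/-- `h₂`, the image of the matrix `E₂₂ - E₃₃`. -/
def h₂ : Usl3 := ι ⟨Matrix.single 1 1 1 - Matrix.single 2 2 1,
  show _ ∈ LinearMap.ker (Matrix.traceLinearMap (Fin 3) ℂ ℂ) by
    simp [LinearMap.mem_ker, Matrix.trace_single_eq_same]⟩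

/-- `e₁`, the image of the matrix `E₁₂`. -/
def e₁ : Usl3 := ι (single (0 : Fin 3) 1 (by decide) (1 : ℂ))

/-- `e₂`, the image of the matrix `E₂₃`. -/
def e₂ : Usl3 := ι (single (1 : Fin 3) 2 (by decide) (1 : ℂ))

/-- `f₁`, the image of the matrix `E₂₁`. -/
def f₁ : Usl3 := ι (single (1 : Fin 3) 0 (by decide) (1 : ℂ))

/-- `f₂`, the image of the matrix `E₃₂`. -/
def f₂ : Usl3 := ι (single (2 : Fin 3) 1 (by decide) (1 : ℂ))

/-- `e₃ := e₁e₂ - e₂e₁`. -/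
def e₃ : Usl3 := e₁ * e₂ - e₂ * e₁

/-- `f₃ := f₂f₁ - f₁f₂`. -/
def f₃ : Usl3 := f₂ * f₁ - f₁ * f₂

/-- `h₃ := h₁ + h₂`. -/
def h₃ : Usl3 := h₁ + h₂

/-- `S := Σ_{n≥0} binom(1/2,n) h^{2n} e₃^{2n}` in `R = U(sl(3,ℂ))[[h]]`. -/
def S : PowerSeries Usl3 :=
  PowerSeries.mk fun m =>
    if m % 2 = 0 then ((qbinom (1/2) (m / 2) : ℚ) : ℂ) • e₃ ^ m else 0

/-- `T := h·e₃ + S`. -/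
def T : PowerSeries Usl3 := PowerSeries.X * PowerSeries.C e₃ + S

/-- `T⁻¹ := -h·e₃ + S`. -/
def Tinv : PowerSeries Usl3 := -(PowerSeries.X * PowerSeries.C e₃) + S

/-- `Σ_{n≥0} binom(α,n)(T-1)ⁿ`, well defined since `T - 1` has zero constant term
(the degree-`m` coefficient only receives contributions from `n ≤ m`). -/
def Tpow (α : ℚ) : PowerSeries Usl3 :=
  PowerSeries.mk fun m =>
    PowerSeries.coeff m
      (∑ n ∈ Finset.range (m + 1), ((qbinom α n : ℚ) : ℂ) • (T - 1) ^ n)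

/-- `T^{1/2} := Σ_{n≥0} binom(1/2,n)(T-1)ⁿ`. -/
def Thalf : PowerSeries Usl3 := Tpow (1/2)

/-- `T^{-1/2} := Σ_{n≥0} binom(-1/2,n)(T-1)ⁿ`. -/
def Tneghalf : PowerSeries Usl3 := Tpow (-(1/2))

/-- `E₁ := T^{1/2}e₁`. -/
def E₁ : PowerSeries Usl3 := Thalf * PowerSeries.C e₁

/-- `E₂ := T^{1/2}e₂`. -/
def E₂ : PowerSeries Usl3 := Thalf * PowerSeries.C e₂

/-- `H₃ := S·h₃`. -/
def H₃ : PowerSeries Usl3 := S * PowerSeries.C h₃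

/-- `F₃ := f₃ - (h²/4)e₃(h₃² - 1)`. -/
def F₃ : PowerSeries Usl3 :=
  PowerSeries.C f₃ -
    (1/4 : ℂ) • (PowerSeries.X ^ 2 * PowerSeries.C (e₃ * (h₃ ^ 2 - 1)))

/-- `H₁ := h₁ - (h/2)e₃T⁻¹h₃`. -/
def H₁ : PowerSeries Usl3 :=
  PowerSeries.C h₁ -
    (1/2 : ℂ) • (PowerSeries.X * PowerSeries.C e₃ * Tinv * PowerSeries.C h₃)

/-- `H₂ := h₂ - (h/2)e₃T⁻¹h₃`. -/
def H₂ : PowerSeries Usl3 :=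
  PowerSeries.C h₂ -
    (1/2 : ℂ) • (PowerSeries.X * PowerSeries.C e₃ * Tinv * PowerSeries.C h₃)

/-- `F₁ := T^{-1/2}(f₁ + (h/2)e₂Th₃)`. -/
def F₁ : PowerSeries Usl3 :=
  Tneghalf * (PowerSeries.C f₁ +
    (1/2 : ℂ) • (PowerSeries.X * PowerSeries.C e₂ * T * PowerSeries.C h₃))

/-- `F₂ := T^{-1/2}(f₂ - (h/2)e₁Th₃)`. -/
def F₂ : PowerSeries Usl3 :=
  Tneghalf * (PowerSeries.C f₂ -
    (1/2 : ℂ) • (PowerSeries.X * PowerSeries.C e₁ * T * PowerSeries.C h₃))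

end Usl3

namespace Usl3

open PowerSeries

section ScalarSeries

theorem qbinom_eq_choose (α : ℚ) (n : ℕ) : qbinom α n = Ring.choose α n := by
  have key : (descPochhammer ℤ n).smeval α = ∏ i ∈ Finset.range n, (α - (i : ℚ)) := by
    induction n with
    | zero => simp
    | succ k ih =>
      rw [descPochhammer_succ_right, Polynomial.smeval_mul, ih, Finset.prod_range_succ]
      simp [Polynomial.smeval_sub, Polynomial.smeval_natCast]
  rw [Ring.choose_eq_smul, key, qbinom, smul_eq_mul, div_eq_inv_mul]

/-- The scalar power series `√(1 + x²)`. -/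
def sqrtSeries : ℂ⟦X⟧ := (PowerSeries.binomialSeries ℂ (1/2 : ℚ)).subst (X ^ 2 : ℂ⟦X⟧)

theorem coeff_sqrtSeries (m : ℕ) :
    coeff m sqrtSeries = if m % 2 = 0 then ((qbinom (1/2) (m / 2) : ℚ) : ℂ) else 0 := by
  rw [sqrtSeries, coeff_subst_X_pow two_ne_zero]
  simp only [Nat.dvd_iff_mod_eq_zero, qbinom_eq_choose, binomialSeries_coeff]
  simp [Rat.smul_def]

theorem sqrtSeries_mul_self : sqrtSeries * sqrtSeries = 1 + X ^ 2 := by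
  have h2 : HasSubst (X ^ 2 : ℂ⟦X⟧) := HasSubst.X_pow two_ne_zero
  have h1 : PowerSeries.binomialSeries ℂ (1 : ℚ) = 1 + X := by
    simpa using binomialSeries_nat (R := ℚ) (A := ℂ) 1
  rw [sqrtSeries, ← subst_mul h2, ← binomialSeries_add]
  norm_num
  rw [h1, subst_add h2, subst_X h2, ← coe_substAlgHom h2, map_one]

theorem constantCoeff_sqrtSeries : constantCoeff sqrtSeries = 1 := by
  rw [← coeff_zero_eq_constantCoeff_apply, coeff_sqrtSeries]
  simp [qbinom]

/-- The scalar power series `x + √(1 + x²)`. -/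
def tSeries : ℂ⟦X⟧ := X + sqrtSeries

theorem hasSubst_tSeries_sub_one : HasSubst (tSeries - 1) :=
  HasSubst.of_constantCoeff_zero' (by simp [tSeries, constantCoeff_sqrtSeries])

/-- The scalar power series `(x + √(1 + x²)) ^ α`. -/
def tPowSeries (α : ℚ) : ℂ⟦X⟧ := (PowerSeries.binomialSeries ℂ α).subst (tSeries - 1)

theorem tPowSeries_add (α β : ℚ) :
    tPowSeries (α + β) = tPowSeries α * tPowSeries β := by
  rw [tPowSeries, binomialSeries_add, subst_mul hasSubst_tSeries_sub_one]; rfl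

theorem tPowSeries_zero : tPowSeries 0 = 1 := by
  rw [tPowSeries, binomialSeries_zero, ← coe_substAlgHom hasSubst_tSeries_sub_one, map_one]

theorem tPowSeries_one : tPowSeries 1 = tSeries := by
  have h1 : PowerSeries.binomialSeries ℂ (1 : ℚ) = 1 + X := by
    simpa using binomialSeries_nat (R := ℚ) (A := ℂ) 1
  rw [tPowSeries, h1, subst_add hasSubst_tSeries_sub_one, subst_X hasSubst_tSeries_sub_one,
    ← coe_substAlgHom hasSubst_tSeries_sub_one, map_one]
  ring

theorem coeff_tPowSeries (α : ℚ) (m : ℕ) :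
    coeff m (tPowSeries α) =
      ∑ n ∈ Finset.range (m + 1), ((qbinom α n : ℚ) : ℂ) * coeff m ((tSeries - 1) ^ n) := by
  rw [tPowSeries, coeff_subst' hasSubst_tSeries_sub_one,
    finsum_eq_sum_of_support_subset (s := Finset.range (m + 1))]
  · refine Finset.sum_congr rfl fun n _ => ?_
    simp [qbinom_eq_choose, Rat.smul_def]
  · intro n hn
    by_contra hlt
    have hlt : m < n := by simpa using hlt
    refine hn ?_
    have hX : (X : ℂ⟦X⟧) ^ n ∣ (tSeries - 1) ^ n :=
      pow_dvd_pow_of_dvd (X_dvd_iff.2 (by simp [tSeries, constantCoeff_sqrtSeries])) n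
    simp [X_pow_dvd_iff.1 hX m hlt]

theorem sqrtSeries_mul_inv : sqrtSeries * sqrtSeries⁻¹ = 1 :=
  PowerSeries.mul_inv_cancel _ (by simp [constantCoeff_sqrtSeries])

theorem tPowSeries_half_mul_neg_half : tPowSeries (1/2) * tPowSeries (-(1/2)) = 1 := by
  rw [← tPowSeries_add, add_neg_cancel, tPowSeries_zero]

theorem tPowSeries_half_mul_self : tPowSeries (1/2) * tPowSeries (1/2) = X + sqrtSeries := by
  rw [← tPowSeries_add, ← tSeries, ← tPowSeries_one]
  norm_num

theorem tPowSeries_neg_half_mul_self :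
    tPowSeries (-(1/2)) * tPowSeries (-(1/2)) = -X + sqrtSeries := by
  linear_combination (-X + sqrtSeries) * (tPowSeries (1/2) * tPowSeries (-(1/2)) + 1) *
      tPowSeries_half_mul_neg_half
    - tPowSeries (-(1/2)) ^ 2 * sqrtSeries_mul_self
    - (-X + sqrtSeries) * tPowSeries (-(1/2)) ^ 2 * tPowSeries_half_mul_self

theorem derivative_tPowSeries_neg_half :
    2 * d⁄dX ℂ (tPowSeries (-(1/2))) = - (tPowSeries (-(1/2)) * sqrtSeries⁻¹) := by
  have hs := congrArg (d⁄dX ℂ) sqrtSeries_mul_self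
  have hq := congrArg (d⁄dX ℂ) tPowSeries_neg_half_mul_self
  simp only [Derivation.leibniz, Derivation.leibniz_pow, map_add, map_neg,
    derivative_X, smul_eq_mul] at hs hq
  have hs' : sqrtSeries * d⁄dX ℂ sqrtSeries = X := by
    have h2 : (2 : ℂ⟦X⟧) ≠ 0 := fun h => by
      simpa using (map_ofNat (constantCoeff (R := ℂ)) 2).symm.trans (congrArg constantCoeff h)
    apply mul_left_cancel₀ h2
    simp at hs
    linear_combination hs
  have hpq := tPowSeries_half_mul_neg_half
  linear_combination tPowSeries (1/2) * hq
    - (2 * d⁄dX ℂ (tPowSeries (-(1/2)))) * hpq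
    + tPowSeries (1/2) * (1 - d⁄dX ℂ sqrtSeries) * sqrtSeries_mul_inv
    + tPowSeries (1/2) * sqrtSeries⁻¹ * hs'
    + tPowSeries (1/2) * sqrtSeries⁻¹ * tPowSeries_neg_half_mul_self
    - tPowSeries (-(1/2)) * sqrtSeries⁻¹ * hpq

end ScalarSeries

section Evaluation

variable {A : Type*} [Ring A] [Algebra ℂ A]

/-- The evaluation `φ(x) ↦ φ(h a)` of scalar power series at `h a`, where `h` is the formal
parameter of `A⟦X⟧`. -/
def evalAt (a : A) : ℂ⟦X⟧ →ₐ[ℂ] A⟦X⟧ where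
  toFun φ := PowerSeries.mk fun n => coeff n φ • a ^ n
  map_one' := by
    ext n
    by_cases h : n = 0 <;> simp [coeff_one, h]
  map_mul' φ ψ := by
    ext n
    simp only [coeff_mk, coeff_mul, Finset.sum_smul]
    refine Finset.sum_congr rfl fun p hp => ?_
    rw [smul_mul_smul_comm, ← pow_add, Finset.HasAntidiagonal.mem_antidiagonal.1 hp]
  map_zero' := by ext n; simp
  map_add' φ ψ := by ext n; simp [add_smul]
  commutes' r := by
    ext n
    by_cases h : n = 0 <;>
      simp [coeff_C, h, Algebra.algebraMap_eq_smul_one]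

@[simp]
theorem coeff_evalAt (a : A) (φ : ℂ⟦X⟧) (n : ℕ) :
    coeff n (evalAt a φ) = coeff n φ • a ^ n :=
  coeff_mk n fun n => coeff n φ • a ^ n

theorem evalAt_X (a : A) : evalAt a X = X * C a := by
  ext n
  rcases n with _ | _ | n <;> simp [coeff_X]

theorem evalAt_commute_C {a b : A} (h : Commute a b) (φ : ℂ⟦X⟧) :
    Commute (evalAt a φ) (C b) := by
  ext n
  simp [(h.pow_left n).eq]

theorem evalAt_mul_C_sub {a b c : A} (h : a * b - b * a = c) (hc : Commute a c) (φ : ℂ⟦X⟧) :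
    evalAt a φ * C b - C b * evalAt a φ = X * evalAt a (d⁄dX ℂ φ) * C c := by
  have key (n : ℕ) : a ^ (n + 1) * b - b * a ^ (n + 1) = ((n : ℂ) + 1) • (a ^ n * c) := by
    induction n with
    | zero => simpa using h
    | succ n ih =>
      have h1 : a ^ (n + 1 + 1) * b - b * a ^ (n + 1 + 1) =
          a ^ (n + 1) * (a * b - b * a) + (a ^ (n + 1) * b - b * a ^ (n + 1)) * a := by
        noncomm_ring
      rw [h1, h, ih, smul_mul_assoc, mul_assoc, ← hc.eq, ← mul_assoc, ← pow_succ]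
      push_cast
      module
  ext n
  rcases n with _ | n
  · have h0 : constantCoeff (evalAt a φ) = coeff 0 φ • 1 := by
      rw [← coeff_zero_eq_constantCoeff_apply, coeff_evalAt, pow_zero]
    simp [mul_assoc, h0]
  · rw [mul_assoc X, coeff_succ_X_mul]
    simp only [map_sub, coeff_mul_C, coeff_C_mul, coeff_evalAt, coeff_derivative]
    rw [smul_mul_assoc, mul_smul_comm, ← smul_sub, key, smul_smul, smul_mul_assoc]

end Evaluation

section TwistedCommutator

theorem twisted_commutator {B : Type*} [Ring B] {q t ti w x y e e' f k : B}
    (hy : ∀ b, Commute y b) (hqe : Commute q e) (hqe' : Commute q e') (hqt : Commute q t)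
    (hte : Commute t e) (hte' : Commute t e') (hqq : q * q = ti) (hqtq : q * t * q = 1)
    (hwx : w * x = 1 - ti * w) (htiwe' : Commute (ti * w) e')
    (hfq : f * q = q * f - y * (q * w * e')) (hkq : k * q = q * k - q * w * x)
    (hke : k * e = e * k + e) :
    (q * e) * (q * (f + y * (e' * t * k))) - (q * (f + y * (e' * t * k))) * (q * e) =
      ti * (e * f - f * e) + y * ((e * e' - e' * e) * k) := by
  have h1 : (q * e) * (q * f) = ti * (e * f) := by
    rw [← hqq]; simp only [mul_assoc]; rw [← mul_assoc e q, ← hqe.eq, mul_assoc]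
  have h2 : (q * f) * (q * e) = ti * (f * e) - y * (ti * w * (e' * e)) := by
    calc (q * f) * (q * e) = q * (f * q) * e := by simp only [mul_assoc]
      _ = q * q * (f * e) - (q * y) * (q * w * (e' * e)) := by rw [hfq]; noncomm_ring
      _ = _ := by rw [← (hy q).eq, ← hqq]; noncomm_ring
  have h3 : (q * e) * (q * (y * (e' * t * k))) = y * (e * e' * k) := by
    calc (q * e) * (q * (y * (e' * t * k))) = (q * e * q) * y * (e' * t) * k := by
          simp only [mul_assoc]
      _ = y * (q * (e * q) * (e' * t) * k) := by
          rw [← (hy (q * e * q)).eq]; simp only [mul_assoc]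
      _ = y * ((q * q) * (e * t) * e' * k) := by
          rw [← hqe.eq, ← hte'.eq]; simp only [mul_assoc]
      _ = y * (q * (q * t) * e * e' * k) := by
          rw [← hte.eq]; simp only [mul_assoc]
      _ = _ := by rw [hqt.eq, ← mul_assoc q t q, hqtq, one_mul]
  have h4 : (q * (y * (e' * t * k))) * (q * e) = y * (e' * e * k + ti * w * (e' * e)) := by
    calc (q * (y * (e' * t * k))) * (q * e) = (q * y) * (e' * t * (k * q) * e) := by
          simp only [mul_assoc]
      _ = y * (q * e' * t * q * (k * e - (w * x) * e)) := by
          rw [← (hy q).eq, hkq]; noncomm_ring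
      _ = y * (e' * (q * t * q) * (k * e - (w * x) * e)) := by
          rw [hqe'.eq]; simp only [mul_assoc]
      _ = y * (e' * e * k + (e' * (ti * w)) * e) := by
          rw [hqtq, hwx, hke]; noncomm_ring
      _ = _ := by rw [← htiwe'.eq]; simp only [mul_assoc]
  rw [mul_add, mul_add, add_mul, h1, h2, h3, h4]
  noncomm_ring

end TwistedCommutator

theorem S_eq : S = evalAt e₃ sqrtSeries := by
  ext m
  rw [S, coeff_mk, coeff_evalAt, coeff_sqrtSeries]
  split_ifs <;> simp

theorem T_eq : T = evalAt e₃ tSeries := by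
  rw [T, S_eq, tSeries, map_add, evalAt_X]

theorem Tinv_eq : Tinv = evalAt e₃ (-X + sqrtSeries) := by
  rw [Tinv, S_eq, map_add, map_neg, evalAt_X]

theorem Tpow_eq (α : ℚ) : Tpow α = evalAt e₃ (tPowSeries α) := by
  ext m
  have hT : T - 1 = evalAt e₃ (tSeries - 1) := by rw [T_eq, map_sub, map_one]
  rw [Tpow, coeff_mk, coeff_evalAt, coeff_tPowSeries, map_sum, Finset.sum_smul]
  refine Finset.sum_congr rfl fun n _ => ?_
  rw [hT, ← map_pow, coeff_smul, coeff_evalAt, smul_smul]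

section Relations

theorem ι_commutator (a b : sl (Fin 3) ℂ) : ι a * ι b - ι b * ι a = ι ⁅a, b⁆ := by
  rw [LieHom.map_lie, LieRing.of_associative_ring_bracket]

theorem e₃_eq : e₃ = ι (single (0 : Fin 3) 2 (by decide) (1 : ℂ)) := by
  rw [e₃, e₁, e₂, ι_commutator]
  congr 1
  apply Subtype.ext
  simp [LieRing.of_associative_ring_bracket]

theorem commute_e₃_e₁ : Commute e₃ e₁ := by
  rw [Commute, SemiconjBy, ← sub_eq_zero, e₃_eq, e₁, ι_commutator, ← map_zero ι]
  congr 1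
  apply Subtype.ext
  simp [LieRing.of_associative_ring_bracket]

theorem commute_e₃_e₂ : Commute e₃ e₂ := by
  rw [Commute, SemiconjBy, ← sub_eq_zero, e₃_eq, e₂, ι_commutator, ← map_zero ι]
  congr 1
  apply Subtype.ext
  simp [LieRing.of_associative_ring_bracket]

theorem e₁_f₁ : e₁ * f₁ - f₁ * e₁ = h₁ := by
  rw [e₁, f₁, h₁, ι_commutator]
  congr 1
  apply Subtype.ext
  simp [LieRing.of_associative_ring_bracket]

theorem e₂_f₂ : e₂ * f₂ - f₂ * e₂ = h₂ := by
  rw [e₂, f₂, h₂, ι_commutator]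
  congr 1
  apply Subtype.ext
  simp [LieRing.of_associative_ring_bracket]

theorem e₁_f₂ : e₁ * f₂ - f₂ * e₁ = 0 := by
  rw [e₁, f₂, ι_commutator, ← map_zero ι]
  congr 1
  apply Subtype.ext
  simp [LieRing.of_associative_ring_bracket]

theorem e₂_f₁ : e₂ * f₁ - f₁ * e₂ = 0 := by
  rw [e₂, f₁, ι_commutator, ← map_zero ι]
  congr 1
  apply Subtype.ext
  simp [LieRing.of_associative_ring_bracket]

theorem e₃_f₁ : e₃ * f₁ - f₁ * e₃ = -e₂ := by
  rw [e₃_eq, f₁, e₂, ι_commutator, ← map_neg]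
  congr 1
  apply Subtype.ext
  simp [LieRing.of_associative_ring_bracket]

theorem e₃_f₂ : e₃ * f₂ - f₂ * e₃ = e₁ := by
  rw [e₃_eq, f₂, e₁, ι_commutator]
  congr 1
  apply Subtype.ext
  simp [LieRing.of_associative_ring_bracket]

theorem h₃_e₁ : h₃ * e₁ - e₁ * h₃ = e₁ := by
  rw [h₃, h₁, h₂, e₁, ← map_add, ι_commutator]
  congr 1
  apply Subtype.ext
  simp [LieRing.of_associative_ring_bracket, sub_mul, mul_sub]

theorem h₃_e₂ : h₃ * e₂ - e₂ * h₃ = e₂ := by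
  rw [h₃, h₁, h₂, e₂, ← map_add, ι_commutator]
  congr 1
  apply Subtype.ext
  simp [LieRing.of_associative_ring_bracket, sub_mul, mul_sub]

theorem e₃_h₃ : e₃ * h₃ - h₃ * e₃ = -(2 * e₃) := by
  rw [e₃]
  have h1 : h₃ * e₁ = e₁ * h₃ + e₁ := sub_eq_iff_eq_add'.1 h₃_e₁
  have h2 : h₃ * e₂ = e₂ * h₃ + e₂ := sub_eq_iff_eq_add'.1 h₃_e₂
  calc (e₁ * e₂ - e₂ * e₁) * h₃ - h₃ * (e₁ * e₂ - e₂ * e₁)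
      = (e₁ * e₂ - e₂ * e₁) * h₃ - ((h₃ * e₁) * e₂ - (h₃ * e₂) * e₁) := by noncomm_ring
    _ = (e₁ * e₂ - e₂ * e₁) * h₃ -
          (e₁ * (h₃ * e₂) + e₁ * e₂ - (e₂ * (h₃ * e₁) + e₂ * e₁)) := by
        rw [h1, h2]; noncomm_ring
        rw [h1, h2]; noncomm_ring
    _ = _ := by rw [h1, h2]; noncomm_ring

end Relations

theorem derivative_tPowSeries_neg_half_eq_smul :
    d⁄dX ℂ (tPowSeries (-(1/2))) = (-(1/2) : ℂ) • (tPowSeries (-(1/2)) * sqrtSeries⁻¹) := by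
  have h := congrArg (fun φ : ℂ⟦X⟧ => (1/2 : ℂ) • φ) derivative_tPowSeries_neg_half
  simp only [two_mul, ← two_smul ℂ, smul_smul] at h
  norm_num at h
  rw [h]
  norm_num

theorem commute_X_smul (r : ℂ) (b : Usl3⟦X⟧) : Commute (r • (X : Usl3⟦X⟧)) b :=
  ((commute_X b).symm).smul_left r

/-- The common shape of the four commutators `[T⁻¹Eᵢ, Fⱼ]`. -/
theorem commutator_E_F {e e' f : Usl3} (he : Commute e₃ e) (he' : Commute e₃ e')
    (hf : e₃ * f - f * e₃ = -e') (hk : h₃ * e - e * h₃ = e) :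
    (Tinv * (Thalf * C e)) * (Tneghalf * (C f + (1/2 : ℂ) • (X * C e' * T * C h₃))) -
      (Tneghalf * (C f + (1/2 : ℂ) • (X * C e' * T * C h₃))) * (Tinv * (Thalf * C e)) =
      Tinv * C (e * f - f * e) + (1/2 : ℂ) • (X * C (e * e' - e' * e) * C h₃) := by
  have hq : Tneghalf = evalAt e₃ (tPowSeries (-(1/2))) := Tpow_eq _
  have hp : Thalf = evalAt e₃ (tPowSeries (1/2)) := Tpow_eq _
  have hTE : Tinv * (Thalf * C e) = Tneghalf * C e := by
    rw [← mul_assoc, Tinv_eq, hp, hq, ← map_mul, ← tPowSeries_neg_half_mul_self]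
    congr 2
    linear_combination tPowSeries (-(1/2)) * tPowSeries_half_mul_neg_half
  have hy (b : Usl3⟦X⟧) : Commute ((1/2 : ℂ) • (X : Usl3⟦X⟧)) b := commute_X_smul _ b
  have hF (c d : Usl3⟦X⟧) : (1/2 : ℂ) • (X * c * d) = ((1/2 : ℂ) • X) * (c * d) := by
    rw [smul_mul_assoc, mul_assoc]
  have hder : evalAt e₃ (d⁄dX ℂ (tPowSeries (-(1/2)))) =
      (-(1/2) : ℂ) • (Tneghalf * evalAt e₃ sqrtSeries⁻¹) := by
    rw [derivative_tPowSeries_neg_half_eq_smul, map_smul, map_mul, hq]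
  rw [hTE, mul_assoc X, hF, hF, map_sub C, map_sub C, map_mul C, map_mul C, map_mul C, map_mul C]
  refine twisted_commutator (w := evalAt e₃ sqrtSeries⁻¹) (x := X * C e₃) hy ?_ ?_ ?_ ?_ ?_ ?_ ?_
    ?_ ?_ ?_ ?_ ?_
  · rw [hq]; exact evalAt_commute_C he _
  · rw [hq]; exact evalAt_commute_C he' _
  · rw [hq, T_eq, Commute, SemiconjBy, ← map_mul, ← map_mul, mul_comm]
  · rw [T_eq]; exact evalAt_commute_C he _
  · rw [T_eq]; exact evalAt_commute_C he' _
  · rw [hq, Tinv_eq, ← map_mul, tPowSeries_neg_half_mul_self]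
  · rw [hq, T_eq, ← map_mul, ← map_mul, ← map_one (evalAt e₃)]
    congr 1
    rw [tSeries, ← tPowSeries_half_mul_self]
    linear_combination (tPowSeries (1/2) * tPowSeries (-(1/2)) + 1) * tPowSeries_half_mul_neg_half
  · rw [← evalAt_X, Tinv_eq, ← map_mul, ← map_mul, ← map_one (evalAt e₃), ← map_sub]
    congr 1
    linear_combination sqrtSeries_mul_inv
  · rw [Tinv_eq, ← map_mul]; exact evalAt_commute_C he' _
  · have h := evalAt_mul_C_sub hf he'.neg_right (tPowSeries (-(1/2)))
    rw [hder, ← hq, map_neg] at h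
    rw [eq_sub_iff_add_eq', ← eq_sub_iff_add_eq, h]
    simp [mul_assoc]
  · have h := evalAt_mul_C_sub e₃_h₃ ((Commute.ofNat_right e₃ 2).mul_right
      (Commute.refl e₃)).neg_right (tPowSeries (-(1/2)))
    rw [hder, ← hq, X_mul, map_neg, two_mul, map_add, ← two_smul ℂ (C e₃)] at h
    rw [eq_sub_iff_add_eq', ← eq_sub_iff_add_eq, ← sub_eq_zero, ← neg_sub, h]
    simp [mul_assoc, X_mul]
  · rw [← map_mul C, ← map_mul C, ← map_add C, sub_eq_iff_eq_add'.1 hk]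

/-- Rewriting of the Cartan part in terms of `H₁` and `H₂`. -/
theorem Tinv_mul_cartan (a b : Usl3) (hab : a + b = h₃) :
    Tinv * C a + (1/2 : ℂ) • (X * C e₃ * C h₃) =
      (1/2 : ℂ) • ((T + Tinv) *
        (C a - (1/2 : ℂ) • (X * C e₃ * Tinv * C h₃))) +
      (1/2 : ℂ) • ((T - Tinv) *
        (C b - (1/2 : ℂ) • (X * C e₃ * Tinv * C h₃))) := by
  have hTT : T * (X * C e₃ * Tinv) = X * C e₃ := by
    rw [T_eq, Tinv_eq, ← evalAt_X, ← map_mul, ← map_mul]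
    congr 1
    rw [tSeries]
    linear_combination X * sqrtSeries_mul_self
  have hb : C b = C h₃ - C a := by rw [← hab, map_add, add_sub_cancel_left]
  have hT : T = Tinv + (2 : ℂ) • (X * C e₃) := by
    rw [T, Tinv]; module
  have h1 : (1/2 : ℂ) • ((T + Tinv) *
        (C a - (1/2 : ℂ) • (X * C e₃ * Tinv * C h₃))) +
      (1/2 : ℂ) • ((T - Tinv) *
        (C b - (1/2 : ℂ) • (X * C e₃ * Tinv * C h₃))) =
      Tinv * C a + (1/2 : ℂ) • ((T - Tinv) * C h₃) -
        (1/2 : ℂ) • (T * (X * C e₃ * Tinv) * C h₃) := by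
    rw [hb]
    simp only [add_mul, sub_mul, mul_sub, mul_smul_comm, mul_assoc]
    module
  rw [h1, hTT]
  rw [hT]
  simp only [add_sub_cancel_left, smul_mul_assoc]
  module

end Usl3

open Usl3 in
/-- In `R = U(sl(3,ℂ))[[h]]` (Jordanian deformation of `sl(3)`):
`[T⁻¹E₁,F₁] = (1/2)(T+T⁻¹)H₁ + (1/2)(T-T⁻¹)H₂`,
`[T⁻¹E₂,F₂] = (1/2)(T+T⁻¹)H₂ + (1/2)(T-T⁻¹)H₁`, and
`[T⁻¹E₁,F₂] = [T⁻¹E₂,F₁] = 0`. -/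
theorem statement_7 :
    (Tinv * E₁) * F₁ - F₁ * (Tinv * E₁) =
      (1/2 : ℂ) • ((T + Tinv) * H₁) + (1/2 : ℂ) • ((T - Tinv) * H₂) ∧
    (Tinv * E₂) * F₂ - F₂ * (Tinv * E₂) =
      (1/2 : ℂ) • ((T + Tinv) * H₂) + (1/2 : ℂ) • ((T - Tinv) * H₁) ∧
    (Tinv * E₁) * F₂ - F₂ * (Tinv * E₁) = 0 ∧
    (Tinv * E₂) * F₁ - F₁ * (Tinv * E₂) = 0 := by
  have hneg : F₂ = Tneghalf * (PowerSeries.C f₂ +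
      (1/2 : ℂ) • (PowerSeries.X * PowerSeries.C (-e₁) * T * PowerSeries.C h₃)) := by
    rw [F₂, map_neg]
    simp only [mul_neg, neg_mul, smul_neg, sub_eq_add_neg]
  have hf₂ : e₃ * f₂ - f₂ * e₃ = -(-e₁) := by rw [neg_neg, e₃_f₂]
  refine ⟨?_, ?_, ?_, ?_⟩
  · rw [E₁, F₁, commutator_E_F commute_e₃_e₁ commute_e₃_e₂ e₃_f₁ h₃_e₁, e₁_f₁, ← e₃]
    exact Tinv_mul_cartan h₁ h₂ rfl
  · have h : e₂ * -e₁ - -e₁ * e₂ = e₃ := by rw [e₃]; noncomm_ring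
    rw [E₂, hneg, commutator_E_F commute_e₃_e₂ commute_e₃_e₁.neg_right hf₂ h₃_e₂, e₂_f₂, h]
    exact Tinv_mul_cartan h₂ h₁ (add_comm h₂ h₁)
  · have h : e₁ * -e₁ - -e₁ * e₁ = 0 := by noncomm_ring
    rw [E₁, hneg, commutator_E_F commute_e₃_e₁ commute_e₃_e₁.neg_right hf₂ h₃_e₁, e₁_f₂, h]
    simp
  · rw [E₂, F₁, commutator_E_F commute_e₃_e₂ commute_e₃_e₂ e₃_f₁ h₃_e₂, e₂_f₁, sub_self]
    simp
end
end

section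
/- In R = U[[h]] (Jordanian deformation of sl(3)): [TF₂,TF₁] = T·(F₃ - (h/2)H₃TH₃ - (h/8)(T - T⁻¹)), and the Serre relations (TF₁)²(TF₂) - 2(TF₁)(TF₂)(TF₁) + (TF₂)(TF₁)² = 0 and (TF₂)²(TF₁) - 2(TF₂)(TF₁)(TF₂) + (TF₁)(TF₂)² = 0 hold ([a,b]=ab-ba). -/
noncomputable section

open LieAlgebra.SpecialLinear

attribute [local instance 100] LieRing.ofAssociativeRing

section AbstractRelations

variable {K R : Type*} [CommRing K] [Algebra ℂ K] [Ring R] [Module K R]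
  (d : Derivation ℂ K K) {x τ s g : K}

/-- If `c` is built from `f₃, h₃` and `a` from `f, e, h₃` as in the Jordanian deformation, where the
commutation of these elements with scalars is governed by a derivation `d`, then `a` and `c`
commute. -/
theorem mul_mul_comm_of_relations (half : K) (hhalf : 2 * half = 1) (dhalf : d half = 0)
    (dx : d x = 1) (dτ : d τ = s * τ) (ds : d s = -(x * s ^ 3)) (dg : d g = half * s * g)
    (hs : s * (τ - x) = 1) (hτ : τ ^ 2 = 1 + 2 * x * τ)
    (X f e f₃ h₃ : R)
    (fk : ∀ (k : K) y, f * (k • y) = k • (f * y) + d k • (X * (e * y)))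
    (ek : ∀ (k : K) y, e * (k • y) = k • (e * y))
    (Xk : ∀ (k : K) y, X * (k • y) = k • (X * y))
    (hk : ∀ (k : K) y, h₃ * (k • y) = k • (h₃ * y) + (2 * x * d k) • y)
    (f₃k : ∀ (k : K) y, f₃ * (k • y) =
      k • (f₃ * y) - d k • (X * (h₃ * y)) - (x * d (d k)) • (X * y))
    (fX : ∀ y, f * (X * y) = X * (f * y))
    (eX : ∀ y, e * (X * y) = X * (e * y))
    (hX : ∀ y, h₃ * (X * y) = X * (h₃ * y))
    (f₃X : ∀ y, f₃ * (X * y) = X * (f₃ * y))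
    (f₃f : ∀ y, f₃ * (f * y) = f * (f₃ * y))
    (f₃e : ∀ y, f₃ * (e * y) = e * (f₃ * y) - f * y)
    (fh : ∀ y, f * (h₃ * y) = h₃ * (f * y) + f * y)
    (he : ∀ y, h₃ * (e * y) = e * (h₃ * y) + e * y)
    (f₃h : ∀ y, f₃ * (h₃ * y) = h₃ * (f₃ * y) + (2 : K) • (f₃ * y))
    (a c : R) (ha : ∀ y, a * y = g • (f * y) + (half * g * τ) • (X * (e * (h₃ * y))))
    (hc : ∀ y, c * y = τ • (f₃ * y) - (half ^ 3 * (τ ^ 4 + 3 * τ ^ 2)) • (X * (h₃ * (h₃ * y)))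
      - (x * τ ^ 3) • (X * (h₃ * y))) (y : R) : a * (c * y) = c * (a * y) := by
  have d2 : d 2 = 0 := by simpa using d.map_natCast 2
  have d3 : d 3 = 0 := by simpa using d.map_natCast 3
  simp only [ha, hc, fk, ek, Xk, hk, f₃k, fX, eX, hX, f₃X, f₃f, f₃e, fh, he, f₃h,
    mul_add, mul_sub, smul_add, smul_sub, smul_smul, Derivation.leibniz, map_add, dx, dτ, ds, dg,
    dhalf, Derivation.leibniz_pow, smul_eq_mul, d2, d3, nsmul_eq_mul]
  match_scalars
  all_goals ring_nf
  all_goals grind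

/-- The bracket of the deformed generators `b` and `a`, computed from commutation relations of the
undeformed ones in which a derivation `d` governs the commutation with scalars. -/
theorem mul_mul_sub_mul_mul_of_relations (half : K) (hhalf : 2 * half = 1) (dhalf : d half = 0)
    (dτ : d τ = s * τ) (dg : d g = half * s * g) (hg : g ^ 2 = τ)
    (hs : s * (τ - x) = 1) (hτ : τ ^ 2 = 1 + 2 * x * τ)
    (X f₁ e₁ f₂ e₂ e₃ f₃ h₁ h₂ h₃ : R)
    (f₁k : ∀ (k : K) y, f₁ * (k • y) = k • (f₁ * y) + d k • (X * (e₂ * y)))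
    (f₂k : ∀ (k : K) y, f₂ * (k • y) = k • (f₂ * y) - d k • (X * (e₁ * y)))
    (e₁k : ∀ (k : K) y, e₁ * (k • y) = k • (e₁ * y))
    (e₂k : ∀ (k : K) y, e₂ * (k • y) = k • (e₂ * y))
    (Xk : ∀ (k : K) y, X * (k • y) = k • (X * y))
    (hk : ∀ (k : K) y, h₃ * (k • y) = k • (h₃ * y) + (2 * x * d k) • y)
    (f₁X : ∀ y, f₁ * (X * y) = X * (f₁ * y))
    (f₂X : ∀ y, f₂ * (X * y) = X * (f₂ * y))
    (e₁X : ∀ y, e₁ * (X * y) = X * (e₁ * y))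
    (e₂X : ∀ y, e₂ * (X * y) = X * (e₂ * y))
    (hX : ∀ y, h₃ * (X * y) = X * (h₃ * y))
    (Xe₃ : ∀ y, X * (e₃ * y) = x • y)
    (f₁e₁ : ∀ y, f₁ * (e₁ * y) = e₁ * (f₁ * y) - h₁ * y)
    (f₂e₂ : ∀ y, f₂ * (e₂ * y) = e₂ * (f₂ * y) - h₂ * y)
    (e₁e₂ : ∀ y, e₁ * (e₂ * y) = e₂ * (e₁ * y) + e₃ * y)
    (f₂f₁ : ∀ y, f₂ * (f₁ * y) = f₁ * (f₂ * y) + f₃ * y)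
    (f₁h : ∀ y, f₁ * (h₃ * y) = h₃ * (f₁ * y) + f₁ * y)
    (f₂h : ∀ y, f₂ * (h₃ * y) = h₃ * (f₂ * y) + f₂ * y)
    (he₁ : ∀ y, h₃ * (e₁ * y) = e₁ * (h₃ * y) + e₁ * y)
    (he₂ : ∀ y, h₃ * (e₂ * y) = e₂ * (h₃ * y) + e₂ * y)
    (h12 : ∀ y, h₁ * y = h₃ * y - h₂ * y)
    (a b c : R) (ha : ∀ y, a * y = g • (f₁ * y) + (half * g * τ) • (X * (e₂ * (h₃ * y))))
    (hb : ∀ y, b * y = g • (f₂ * y) - (half * g * τ) • (X * (e₁ * (h₃ * y))))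
    (hc : ∀ y, c * y = τ • (f₃ * y) - (half ^ 3 * (τ ^ 4 + 3 * τ ^ 2)) • (X * (h₃ * (h₃ * y)))
      - (x * τ ^ 3) • (X * (h₃ * y))) (y : R) : b * (a * y) - a * (b * y) = c * y := by
  simp only [ha, hb, hc, f₁k, f₂k, e₁k, e₂k, Xk, hk, f₁X, f₂X, e₁X, e₂X, hX, Xe₃, f₁e₁, f₂e₂,
    e₁e₂, f₂f₁, f₁h, f₂h, he₁, he₂, h12,
    mul_add, mul_sub, smul_add, smul_sub, smul_smul, Derivation.leibniz, dτ, dg,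
    dhalf, smul_eq_mul]
  match_scalars
  all_goals ring_nf
  all_goals grind

end AbstractRelations

theorem sq_mul_sub_two_mul_add {R : Type*} [Ring R] {a b : R}
    (h : Commute a (b * a - a * b)) : a ^ 2 * b - 2 * (a * b * a) + b * a ^ 2 = 0 := by
  have h' : a * (b * a - a * b) - (b * a - a * b) * a = 0 := sub_eq_zero.2 h.eq
  rw [← neg_eq_zero, ← h']
  noncomm_ring

section Jordanian

open PowerSeries

section Series

theorem qbinom_eq_choose (α : ℚ) (n : ℕ) : qbinom α n = Ring.choose α n := by
  rw [Ring.choose_eq_smul, qbinom, ← Polynomial.aeval_eq_smeval, Polynomial.aeval_def,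
    ← Polynomial.eval_map, algebraMap_int_eq, descPochhammer_map,
    descPochhammer_eval_eq_prod_range, smul_eq_mul, div_eq_inv_mul]

theorem coeff_pow_eq_zero {f : ℂ⟦X⟧} (hf : constantCoeff f = 0) {m n : ℕ} (h : m < n) :
    coeff m (f ^ n) = 0 :=
  X_pow_dvd_iff.1 (pow_dvd_pow_of_dvd (X_dvd_iff.2 hf) n) m h

/-- The power series `Σ binom(1/2,n) X^{2n}`, a square root of `1 + X²`. -/
def sig : ℂ⟦X⟧ := mk fun m => if m % 2 = 0 then ((qbinom (1/2) (m / 2) : ℚ) : ℂ) else 0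

/-- The power series `X + sqrt(1 + X²)`. -/
def tau : ℂ⟦X⟧ := X + sig

/-- The power series `Σ binom(α,n)(tau-1)ⁿ`. -/
def tauPow (α : ℚ) : ℂ⟦X⟧ := mk fun m =>
  coeff m (∑ n ∈ Finset.range (m + 1), ((qbinom α n : ℚ) : ℂ) • (tau - 1) ^ n)

theorem sig_eq_subst : sig = (PowerSeries.binomialSeries ℂ (1/2 : ℚ)).subst (X ^ 2 : ℂ⟦X⟧) := by
  ext n
  rw [coeff_subst_X_pow two_ne_zero]
  simp [sig, qbinom_eq_choose, Nat.dvd_iff_mod_eq_zero, Algebra.smul_def]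

theorem sig_sq : sig ^ 2 = 1 + X ^ 2 := by
  have h : HasSubst (X ^ 2 : ℂ⟦X⟧) := HasSubst.X_pow two_ne_zero
  have h1 : (PowerSeries.binomialSeries ℂ (1/2 : ℚ)) ^ 2 = 1 + X := by
    rw [sq, ← binomialSeries_add, add_halves]
    simpa using binomialSeries_nat (R := ℚ) (A := ℂ) 1
  rw [sig_eq_subst, ← subst_pow h, h1, ← coe_substAlgHom h, map_add, map_one,
    coe_substAlgHom h, subst_X h]

theorem constantCoeff_sig : constantCoeff sig = 1 := by
  simp [sig, qbinom, ← coeff_zero_eq_constantCoeff_apply]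

theorem constantCoeff_tau : constantCoeff tau = 1 := by
  simp [tau, constantCoeff_sig]

theorem hasSubst_tau : HasSubst (tau - 1) :=
  HasSubst.of_constantCoeff_zero' (by simp [constantCoeff_tau])

theorem tauPow_eq_subst (α : ℚ) : tauPow α = (PowerSeries.binomialSeries ℂ α).subst (tau - 1) := by
  ext m
  rw [coeff_subst' hasSubst_tau, finsum_eq_sum_of_support_subset (s := Finset.range (m + 1))]
  · simp [tauPow, qbinom_eq_choose, Algebra.smul_def]
  · intro n hn
    by_contra h
    refine hn ?_
    beta_reduce
    rw [coeff_pow_eq_zero (by simp [constantCoeff_tau]) (by simpa using h), smul_zero]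

theorem tauPow_neg_half_sq_mul : tauPow (-(1/2)) ^ 2 * tau = 1 := by
  have h1 : (PowerSeries.binomialSeries ℂ (-(1/2) : ℚ)) ^ 2 * (1 + X) = 1 := by
    have := binomialSeries_nat (R := ℚ) (A := ℂ) 1
    rw [pow_one] at this
    rw [sq, ← this, ← binomialSeries_add, ← binomialSeries_add, ← binomialSeries_zero (R := ℚ)]
    norm_num
  have h := congrArg (substAlgHom hasSubst_tau) h1
  rw [map_mul, map_pow, map_add, map_one, substAlgHom_X, coe_substAlgHom, ← tauPow_eq_subst] at h
  simpa using h

theorem sig_inv_mul : sig⁻¹ * sig = 1 :=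
  PowerSeries.inv_mul_cancel _ (by simp [constantCoeff_sig])

theorem tau_sq : tau ^ 2 = 1 + 2 * X * tau := by
  rw [tau]
  linear_combination sig_sq

theorem two_mul_C_half : 2 * (C (1/2) : ℂ⟦X⟧) = 1 := by
  rw [← map_ofNat C 2, ← map_mul]; norm_num

theorem derivative_sig : d⁄dX ℂ sig = X * sig⁻¹ := by
  have h := congrArg (d⁄dX ℂ) sig_sq
  simp only [Derivation.leibniz_pow, map_add, derivative_X, Derivation.map_one_eq_zero,
    nsmul_eq_mul, smul_eq_mul] at h
  have h2 : (2 : ℂ⟦X⟧) * (sig * d⁄dX ℂ sig - X) = 0 := by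
    push_cast at h; linear_combination h
  have h3 := (mul_eq_zero.1 h2).resolve_left fun h0 => by
    simpa [h0] using two_mul_C_half
  linear_combination sig⁻¹ * h3 - d⁄dX ℂ sig * sig_inv_mul

theorem derivative_tau : d⁄dX ℂ tau = sig⁻¹ * tau := by
  rw [tau, map_add, derivative_sig, derivative_X]
  linear_combination -sig_inv_mul

theorem derivative_sig_inv : d⁄dX ℂ sig⁻¹ = -(X * sig⁻¹ ^ 3) := by
  rw [derivative_inv', derivative_sig]; ring

/-- The square root of `tau` with constant term `1`. -/
def tauHalf : ℂ⟦X⟧ := tau * tauPow (-(1/2))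

theorem tauHalf_sq : tauHalf ^ 2 = tau := by
  rw [tauHalf]; linear_combination tau * tauPow_neg_half_sq_mul

theorem derivative_tauHalf : d⁄dX ℂ tauHalf = C (1/2) * sig⁻¹ * tauHalf := by
  have h := congrArg (d⁄dX ℂ) tauHalf_sq
  rw [derivative_tau, derivative_pow, ← tauHalf_sq] at h
  have h1 : tauHalf * tauPow (-(1/2)) = 1 := by
    rw [tauHalf]; linear_combination tauPow_neg_half_sq_mul
  push_cast at h
  norm_num at h
  linear_combination C (1/2) * tauPow (-(1/2)) * h -
    (d⁄dX ℂ tauHalf - C (1/2) * sig⁻¹ * tauHalf) * h1 -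
    tauHalf * tauPow (-(1/2)) * d⁄dX ℂ tauHalf * two_mul_C_half

end Series

section Eval

theorem C_mul_C_mul {A : Type*} [Ring A] {a b c : A} (h : a * b = b * a + c) (y : A⟦X⟧) :
    C a * (C b * y) = C b * (C a * y) + C c * y := by
  simp only [← mul_assoc, ← map_mul, ← add_mul, ← map_add, h]

theorem C_mul_X_mul {A : Type*} [Ring A] (a : A) (y : A⟦X⟧) :
    C a * (X * y) = X * (C a * y) := by
  rw [← mul_assoc, ← X_mul, mul_assoc]

variable {A : Type*} [Ring A] [Algebra ℂ A]

/-- Substitution of `u * X` into a complex power series. -/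
def evalMulX (u : A) : ℂ⟦X⟧ →+* A⟦X⟧ where
  toFun p := mk fun n => coeff n p • u ^ n
  map_zero' := by ext; simp
  map_one' := by
    ext n
    by_cases h : n = 0 <;> simp [coeff_one, h]
  map_add' p q := by ext; simp [add_smul]
  map_mul' p q := by
    ext n
    simp only [coeff_mk, coeff_mul, Finset.sum_smul]
    refine Finset.sum_congr rfl fun i hi => ?_
    rw [smul_mul_smul_comm, ← pow_add, Finset.HasAntidiagonal.mem_antidiagonal.1 hi]

@[simp]
theorem coeff_evalMulX (u : A) (p : ℂ⟦X⟧) (n : ℕ) :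
    coeff n (evalMulX u p) = coeff n p • u ^ n := by
  simp [evalMulX]

theorem evalMulX_X (u : A) : evalMulX u X = X * C u := by
  ext n
  rw [coeff_evalMulX, X_mul, coeff_C_mul, coeff_X, coeff_X]
  split_ifs with h <;> simp [h]

theorem evalMulX_C (u : A) (c : ℂ) (y : A⟦X⟧) : evalMulX u (C c) * y = c • y := by
  have : evalMulX u (C c) = C (algebraMap ℂ A c) := by
    ext n
    rw [coeff_evalMulX, coeff_C, coeff_C]
    split_ifs with h <;> simp [h, Algebra.algebraMap_eq_smul_one]
  ext n
  rw [this, coeff_C_mul, coeff_smul, Algebra.smul_def]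

theorem mul_pow_of_commutator {a b u : A} (h : a * u = u * a + b) (hb : Commute b u) (n : ℕ) :
    a * u ^ (n + 1) = u ^ (n + 1) * a + ((n : ℂ) + 1) • (u ^ n * b) := by
  induction n with
  | zero => simp [h]
  | succ n ih =>
    rw [pow_succ, ← mul_assoc, ih, add_mul, mul_assoc, h, smul_mul_assoc, mul_assoc _ b, hb.eq,
      ← mul_assoc _ u, ← pow_succ, mul_add, ← mul_assoc, ← pow_succ]
    push_cast
    module

theorem C_mul_evalMulX_mul {a b u : A} (h : a * u = u * a + b) (hb : Commute b u) (p : ℂ⟦X⟧)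
    (y : A⟦X⟧) : C a * (evalMulX u p * y) =
      evalMulX u p * (C a * y) + evalMulX u (d⁄dX ℂ p) * (X * (C b * y)) := by
  suffices C a * evalMulX u p = evalMulX u p * C a + evalMulX u (d⁄dX ℂ p) * (X * C b) by
    simp only [← mul_assoc, this, add_mul]
  rw [X_mul, ← mul_assoc]
  ext n
  cases n with
  | zero =>
    rw [map_add, coeff_C_mul, coeff_zero_mul_X, coeff_mul_C]
    simp
  | succ n =>
    rw [map_add, coeff_C_mul, coeff_succ_mul_X, coeff_mul_C, coeff_mul_C, coeff_evalMulX,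
      coeff_evalMulX, mul_smul_comm, mul_pow_of_commutator h hb, coeff_derivative, mul_smul,
      smul_mul_assoc, smul_mul_assoc, smul_add, smul_mul_assoc]

end Eval

namespace Usl3

theorem evalMulX_sig : evalMulX e₃ sig = S := by
  ext n
  simp [sig, S, ite_smul]

theorem evalMulX_tau : evalMulX e₃ tau = T := by
  rw [tau, map_add, evalMulX_X, evalMulX_sig, T]

theorem evalMulX_tauPow (α : ℚ) : evalMulX e₃ (tauPow α) = Tpow α := by
  ext m
  rw [coeff_evalMulX, tauPow, coeff_mk, Tpow, coeff_mk, ← coeff_evalMulX, map_sum]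
  congr 1
  refine Finset.sum_congr rfl fun n _ => ?_
  rw [smul_eq_C_mul, map_mul, evalMulX_C, map_pow, map_sub, map_one, evalMulX_tau]

theorem ι_mul_ι {a b c : sl (Fin 3) ℂ} (h : (a * b - b * a : Matrix (Fin 3) (Fin 3) ℂ) = c) :
    ι a * ι b = ι b * ι a + ι c := by
  rw [show c = ⁅a, b⁆ from Subtype.ext h.symm, LieHom.map_lie, Ring.lie_def, add_sub_cancel]

theorem ι_mul_ι_neg {a b c : sl (Fin 3) ℂ}
    (h : (a * b - b * a : Matrix (Fin 3) (Fin 3) ℂ) = -c) :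
    ι a * ι b = ι b * ι a + -ι c := by
  rw [← map_neg]
  exact ι_mul_ι h

theorem commute_ι {a b : sl (Fin 3) ℂ} (h : (a * b - b * a : Matrix (Fin 3) (Fin 3) ℂ) = 0) :
    Commute (ι a) (ι b) := by
  simpa [Commute, SemiconjBy] using ι_mul_ι (c := 0) h

theorem f₃_eq : f₃ = ι (single (2 : Fin 3) 0 (by decide) (1 : ℂ)) := by
  rw [f₃, sub_eq_iff_eq_add', f₁, f₂]
  exact ι_mul_ι (by simp)

theorem f₁_mul_e₃ : f₁ * e₃ = e₃ * f₁ + e₂ := by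
  rw [f₁, e₃_eq, e₂]
  exact ι_mul_ι (by simp)

theorem f₂_mul_e₃ : f₂ * e₃ = e₃ * f₂ + -e₁ := by
  rw [f₂, e₃_eq, e₁]
  exact ι_mul_ι_neg (by simp)

theorem commute_e₁_e₃ : Commute e₁ e₃ := by
  rw [e₁, e₃_eq]
  exact commute_ι (by simp)

theorem commute_e₂_e₃ : Commute e₂ e₃ := by
  rw [e₂, e₃_eq]
  exact commute_ι (by simp)

theorem f₁_mul_e₁ : f₁ * e₁ = e₁ * f₁ + -h₁ := by
  rw [f₁, e₁, h₁]
  exact ι_mul_ι_neg (by simp)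

theorem f₂_mul_e₂ : f₂ * e₂ = e₂ * f₂ + -h₂ := by
  rw [f₂, e₂, h₂]
  exact ι_mul_ι_neg (by simp)

theorem commute_f₃_f₁ : Commute f₃ f₁ := by
  rw [f₃_eq, f₁]
  exact commute_ι (by simp)

theorem commute_f₃_f₂ : Commute f₃ f₂ := by
  rw [f₃_eq, f₂]
  exact commute_ι (by simp)

theorem f₃_mul_e₂ : f₃ * e₂ = e₂ * f₃ + -f₁ := by
  rw [f₃_eq, e₂, f₁]
  exact ι_mul_ι_neg (by simp)

theorem f₃_mul_e₁ : f₃ * e₁ = e₁ * f₃ + f₂ := by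
  rw [f₃_eq, e₁, f₂]
  exact ι_mul_ι (by simp)

theorem h₃_mul_e₁ : h₃ * e₁ = e₁ * h₃ + e₁ := by
  rw [h₃, h₁, h₂, e₁, ← map_add]
  exact ι_mul_ι (by simp [Matrix.sub_mul, Matrix.mul_sub])

theorem h₃_mul_e₂ : h₃ * e₂ = e₂ * h₃ + e₂ := by
  rw [h₃, h₁, h₂, e₂, ← map_add]
  exact ι_mul_ι (by simp [Matrix.sub_mul, Matrix.mul_sub])

theorem h₃_mul_e₃ : h₃ * e₃ = e₃ * h₃ + (2 : ℂ) • e₃ := by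
  rw [h₃, h₁, h₂, e₃_eq, ← map_add, ← map_smul]
  exact ι_mul_ι (by
    simp [Matrix.sub_mul, Matrix.mul_sub]
    rw [← Matrix.single_add]; norm_num)

theorem h₃_mul_f₁ : h₃ * f₁ = f₁ * h₃ + -f₁ := by
  rw [h₃, h₁, h₂, f₁, ← map_add]
  exact ι_mul_ι_neg (by simp [Matrix.sub_mul, Matrix.mul_sub])

theorem h₃_mul_f₂ : h₃ * f₂ = f₂ * h₃ + -f₂ := by
  rw [h₃, h₁, h₂, f₂, ← map_add]
  exact ι_mul_ι_neg (by simp [Matrix.sub_mul, Matrix.mul_sub])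

theorem h₃_mul_f₃ : h₃ * f₃ = f₃ * h₃ + -((2 : ℂ) • f₃) := by
  rw [h₃, h₁, h₂, f₃_eq, ← map_add, ← map_smul]
  exact ι_mul_ι_neg (by
    simp [Matrix.sub_mul, Matrix.mul_sub]
    rw [← neg_add', ← Matrix.single_add]; norm_num)

/-- `ℂ⟦X⟧` acts on `Usl3⟦X⟧` by substituting `h·e₃` and multiplying on the left. -/
abbrev leftModule : Module ℂ⟦X⟧ Usl3⟦X⟧ := Module.compHom _ (evalMulX e₃)

attribute [local instance] leftModule

/- Without these, the `ℕ`- and `ℤ`-algebra structures on `ℂ⟦X⟧` are found through those of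
multivariate power series, and `match_scalars` fails. -/
attribute [local instance 2000] Semiring.toNatAlgebra Ring.toIntAlgebra

theorem smul_eq (k : ℂ⟦X⟧) (y : Usl3⟦X⟧) : k • y = evalMulX e₃ k * y := rfl

theorem smul_mul_eq (k : ℂ⟦X⟧) (y z : Usl3⟦X⟧) : k • y * z = k • (y * z) := mul_assoc _ _ _

theorem T_mul (y : Usl3⟦X⟧) : T * y = tau • y := by rw [← evalMulX_tau, smul_eq]

theorem S_mul (y : Usl3⟦X⟧) : S * y = sig • y := by rw [← evalMulX_sig, smul_eq]

theorem complex_smul_mul (c : ℂ) (y z : Usl3⟦X⟧) : (c • y) * z = (C c : ℂ⟦X⟧) • (y * z) := by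
  rw [smul_eq, evalMulX_C, smul_mul_assoc]

theorem T_mul_Tneghalf_mul (y : Usl3⟦X⟧) : T * (Tneghalf * y) = tauHalf • y := by
  rw [smul_eq, tauHalf, map_mul, evalMulX_tau, evalMulX_tauPow, Tneghalf, mul_assoc]

theorem X_mul_smul (k : ℂ⟦X⟧) (y : Usl3⟦X⟧) :
    (X : Usl3⟦X⟧) * k • y = k • (X * y) := by
  rw [smul_eq, smul_eq, ← mul_assoc, ← mul_assoc, X_mul]

theorem X_mul_C_e₃_mul (y : Usl3⟦X⟧) : X * (C e₃ * y) = (X : ℂ⟦X⟧) • y := by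
  rw [smul_eq, evalMulX_X, mul_assoc]

theorem C_mul_smul {a b : Usl3} (h : a * e₃ = e₃ * a + b) (hb : Commute b e₃) (k : ℂ⟦X⟧)
    (y : Usl3⟦X⟧) : C a * k • y = k • (C a * y) + d⁄dX ℂ k • (X * (C b * y)) :=
  C_mul_evalMulX_mul h hb k y

theorem C_mul_smul_of_commute {a : Usl3} (h : Commute a e₃) (k : ℂ⟦X⟧)
    (y : Usl3⟦X⟧) : C a * k • y = k • (C a * y) := by
  rw [C_mul_smul (b := 0) (by rw [h.eq, add_zero]) (Commute.zero_left _)]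
  simp

theorem C_mul_C_mul_of_commute {a b : Usl3} (h : Commute a b) (y : Usl3⟦X⟧) :
    C a * (C b * y) = C b * (C a * y) := by
  rw [← mul_assoc, ← map_mul, h.eq, map_mul, mul_assoc]

theorem C_f₁_mul_smul (k : ℂ⟦X⟧) (y : Usl3⟦X⟧) :
    C f₁ * k • y = k • (C f₁ * y) + d⁄dX ℂ k • (X * (C e₂ * y)) :=
  C_mul_smul f₁_mul_e₃ commute_e₂_e₃ k y

theorem C_f₂_mul_smul (k : ℂ⟦X⟧) (y : Usl3⟦X⟧) :
    C f₂ * k • y = k • (C f₂ * y) + d⁄dX ℂ k • (X * (C (-e₁) * y)) :=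
  C_mul_smul f₂_mul_e₃ commute_e₁_e₃.neg_left k y

theorem C_h₃_mul_smul (k : ℂ⟦X⟧) (y : Usl3⟦X⟧) :
    C h₃ * k • y = k • (C h₃ * y) + (2 * X * d⁄dX ℂ k) • y := by
  rw [C_mul_smul h₃_mul_e₃ ((Commute.refl e₃).smul_left _)]
  rw [two_smul, map_add, add_mul, mul_add, X_mul_C_e₃_mul]
  module

theorem C_f₃_mul (y : Usl3⟦X⟧) : C f₃ * y = C f₂ * (C f₁ * y) - C f₁ * (C f₂ * y) := by
  rw [f₃, map_sub, map_mul, map_mul, sub_mul, mul_assoc, mul_assoc]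

theorem C_h₃_mul (y : Usl3⟦X⟧) : C h₃ * y = C h₁ * y + C h₂ * y := by
  rw [h₃, map_add, add_mul]

theorem C_e₁_mul_C_e₂_mul (y : Usl3⟦X⟧) : C e₁ * (C e₂ * y) = C e₂ * (C e₁ * y) + C e₃ * y :=
  C_mul_C_mul (by rw [e₃]; abel) y

theorem C_f₃_mul_smul (k : ℂ⟦X⟧) (y : Usl3⟦X⟧) : C f₃ * k • y =
    k • (C f₃ * y) - d⁄dX ℂ k • (X * (C h₃ * y)) - (X * d⁄dX ℂ (d⁄dX ℂ k)) • (X * y) := by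
  simp only [C_f₃_mul, C_h₃_mul, C_f₁_mul_smul, C_f₂_mul_smul, mul_add, C_mul_X_mul,
    C_mul_C_mul f₁_mul_e₁, C_mul_C_mul f₂_mul_e₂, map_neg, neg_mul, mul_neg, smul_add, smul_neg,
    C_e₁_mul_C_e₂_mul, X_mul_C_e₃_mul, X_mul_smul]
  module

theorem T_mul_F₁_mul (y : Usl3⟦X⟧) : T * F₁ * y =
    tauHalf • (C f₁ * y) + (C (1/2) * tauHalf * tau) • (X * (C e₂ * (C h₃ * y))) := by
  rw [F₁, T_mul_Tneghalf_mul]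
  simp only [smul_mul_eq, add_mul, complex_smul_mul, mul_assoc, T_mul,
    C_mul_smul_of_commute commute_e₂_e₃, X_mul_smul]
  module

theorem T_mul_F₂_mul (y : Usl3⟦X⟧) : T * F₂ * y =
    tauHalf • (C f₂ * y) + (C (1/2) * tauHalf * tau) • (X * (C (-e₁) * (C h₃ * y))) := by
  rw [F₂, T_mul_Tneghalf_mul]
  simp only [smul_mul_eq, sub_mul, complex_smul_mul, mul_assoc, T_mul,
    C_mul_smul_of_commute commute_e₁_e₃, X_mul_smul, map_neg, neg_mul, mul_neg]
  module

theorem bracket_mul (y : Usl3⟦X⟧) :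
    T * (F₃ - (1/2 : ℂ) • (X * (H₃ * T * H₃)) - (1/8 : ℂ) • (X * (T - Tinv))) * y =
      tau • (C f₃ * y) - (C (1/2) ^ 3 * (tau ^ 4 + 3 * tau ^ 2)) • (X * (C h₃ * (C h₃ * y)))
      - (X * tau ^ 3) • (X * (C h₃ * y)) := by
  have hT : T - Tinv = (2 : ℂ) • (X * C e₃) := by rw [T, Tinv]; module
  have h4 : (C (1/4) : ℂ⟦X⟧) = C (1/2) ^ 2 := by rw [← map_pow]; norm_num
  have h8 : (C (1/8) : ℂ⟦X⟧) = C (1/2) ^ 3 := by rw [← map_pow]; norm_num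
  have h2 : (C 2 : ℂ⟦X⟧) = 2 := map_ofNat C 2
  rw [T_mul, hT, F₃, H₃]
  simp only [smul_mul_eq, sub_mul, complex_smul_mul, mul_assoc, T_mul, S_mul, pow_two (X : Usl3⟦X⟧),
    map_mul, map_sub, map_one, one_mul, pow_two h₃, X_mul_C_e₃_mul]
  simp only [X_mul_smul, mul_sub, C_h₃_mul_smul, smul_add, smul_sub, smul_smul, mul_add, h4, h8, h2,
    Derivation.leibniz, derivative_sig, derivative_tau, smul_eq_mul]
  have hs := sig_inv_mul
  have ht := tau_sq
  have hx : sig = tau - X := by rw [tau]; ring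
  have hh := two_mul_C_half
  rw [hx] at hs ⊢
  generalize (C (1/2) : ℂ⟦X⟧) = half at *
  generalize (tau - X)⁻¹ = s at *
  match_scalars
  all_goals grind

theorem sig_inv_mul_tau_sub_X : sig⁻¹ * (tau - X) = 1 := by
  rw [tau, add_sub_cancel_left, sig_inv_mul]

theorem C_f₁_mul_C_h₃_mul (y : Usl3⟦X⟧) : C f₁ * (C h₃ * y) = C h₃ * (C f₁ * y) + C f₁ * y := by
  rw [C_mul_C_mul h₃_mul_f₁, map_neg, neg_mul, neg_add_cancel_right]

theorem C_f₂_mul_C_h₃_mul (y : Usl3⟦X⟧) : C f₂ * (C h₃ * y) = C h₃ * (C f₂ * y) + C f₂ * y := by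
  rw [C_mul_C_mul h₃_mul_f₂, map_neg, neg_mul, neg_add_cancel_right]

theorem C_f₃_mul_C_h₃_mul (y : Usl3⟦X⟧) :
    C f₃ * (C h₃ * y) = C h₃ * (C f₃ * y) + (2 : ℂ⟦X⟧) • (C f₃ * y) := by
  rw [C_mul_C_mul h₃_mul_f₃, map_neg, neg_mul, two_smul, two_smul, map_add, add_mul,
    neg_add_cancel_right]

theorem lie_T_mul_F₂_T_mul_F₁ : T * F₂ * (T * F₁) - T * F₁ * (T * F₂) =
    T * (F₃ - (1/2 : ℂ) • (X * (H₃ * T * H₃)) - (1/8 : ℂ) • (X * (T - Tinv))) := by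
  have key := mul_mul_sub_mul_mul_of_relations (d⁄dX ℂ) (C (1/2) : ℂ⟦X⟧) two_mul_C_half derivative_C
    derivative_tau derivative_tauHalf tauHalf_sq sig_inv_mul_tau_sub_X tau_sq
    (X : Usl3⟦X⟧) (C f₁) (C e₁) (C f₂) (C e₂) (C e₃) (C f₃) (C h₁) (C h₂) (C h₃)
    C_f₁_mul_smul (fun k y => by
      rw [C_f₂_mul_smul, map_neg, neg_mul, mul_neg, smul_neg, sub_eq_add_neg])
    (C_mul_smul_of_commute commute_e₁_e₃) (C_mul_smul_of_commute commute_e₂_e₃)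
    X_mul_smul C_h₃_mul_smul (C_mul_X_mul _) (C_mul_X_mul _) (C_mul_X_mul _) (C_mul_X_mul _)
    (C_mul_X_mul _) X_mul_C_e₃_mul
    (fun y => by rw [C_mul_C_mul f₁_mul_e₁, map_neg, neg_mul, sub_eq_add_neg])
    (fun y => by rw [C_mul_C_mul f₂_mul_e₂, map_neg, neg_mul, sub_eq_add_neg])
    C_e₁_mul_C_e₂_mul (fun y => by rw [C_f₃_mul, add_sub_cancel])
    C_f₁_mul_C_h₃_mul C_f₂_mul_C_h₃_mul
    (C_mul_C_mul h₃_mul_e₁) (C_mul_C_mul h₃_mul_e₂)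
    (fun y => by rw [C_h₃_mul, add_sub_cancel_right])
    (T * F₁) (T * F₂) _ T_mul_F₁_mul
    (fun y => by rw [T_mul_F₂_mul, map_neg, neg_mul, mul_neg, smul_neg, sub_eq_add_neg])
    bracket_mul 1
  simpa only [mul_one] using key

theorem commute_T_mul_F₁_bracket : Commute (T * F₁)
    (T * (F₃ - (1/2 : ℂ) • (X * (H₃ * T * H₃)) - (1/8 : ℂ) • (X * (T - Tinv)))) := by
  have key := mul_mul_comm_of_relations (d⁄dX ℂ) (C (1/2) : ℂ⟦X⟧) two_mul_C_half derivative_C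
    derivative_X derivative_tau derivative_sig_inv derivative_tauHalf sig_inv_mul_tau_sub_X tau_sq
    (X : Usl3⟦X⟧) (C f₁) (C e₂) (C f₃) (C h₃)
    C_f₁_mul_smul (C_mul_smul_of_commute commute_e₂_e₃) X_mul_smul C_h₃_mul_smul C_f₃_mul_smul
    (C_mul_X_mul _) (C_mul_X_mul _) (C_mul_X_mul _) (C_mul_X_mul _)
    (C_mul_C_mul_of_commute commute_f₃_f₁)
    (fun y => by rw [C_mul_C_mul f₃_mul_e₂, map_neg, neg_mul, sub_eq_add_neg])
    C_f₁_mul_C_h₃_mul (C_mul_C_mul h₃_mul_e₂) C_f₃_mul_C_h₃_mul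
    (T * F₁) _ T_mul_F₁_mul bracket_mul 1
  rwa [mul_one, mul_one] at key

theorem commute_T_mul_F₂_bracket : Commute (T * F₂)
    (T * (F₃ - (1/2 : ℂ) • (X * (H₃ * T * H₃)) - (1/8 : ℂ) • (X * (T - Tinv)))) := by
  have key := mul_mul_comm_of_relations (d⁄dX ℂ) (C (1/2) : ℂ⟦X⟧) two_mul_C_half derivative_C
    derivative_X derivative_tau derivative_sig_inv derivative_tauHalf sig_inv_mul_tau_sub_X tau_sq
    (X : Usl3⟦X⟧) (C f₂) (C (-e₁)) (C f₃) (C h₃)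
    C_f₂_mul_smul (C_mul_smul_of_commute commute_e₁_e₃.neg_left) X_mul_smul C_h₃_mul_smul
    C_f₃_mul_smul (C_mul_X_mul _) (C_mul_X_mul _) (C_mul_X_mul _) (C_mul_X_mul _)
    (C_mul_C_mul_of_commute commute_f₃_f₂)
    (fun y => by
      rw [map_neg, neg_mul, neg_mul, mul_neg, C_mul_C_mul f₃_mul_e₁, neg_add, sub_eq_add_neg])
    C_f₂_mul_C_h₃_mul
    (fun y => by rw [map_neg, neg_mul, neg_mul, mul_neg, C_mul_C_mul h₃_mul_e₁, neg_add])
    C_f₃_mul_C_h₃_mul (T * F₂) _ T_mul_F₂_mul bracket_mul 1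
  rwa [mul_one, mul_one] at key

end Usl3

end Jordanian

set_option maxHeartbeats 1000000 in
open Usl3 in
/-- In `R = U(sl(3,ℂ))[[h]]` (Jordanian deformation of `sl(3)`):
`[TF₂,TF₁] = T(F₃ - (h/2)H₃TH₃ - (h/8)(T - T⁻¹))` and the Serre relations for
`TF₁, TF₂`. -/
theorem statement_10 :
    (T * F₂) * (T * F₁) - (T * F₁) * (T * F₂) =
      T * (F₃ - (1/2 : ℂ) • (PowerSeries.X * (H₃ * T * H₃)) -
        (1/8 : ℂ) • (PowerSeries.X * (T - Tinv))) ∧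
    (T * F₁) ^ 2 * (T * F₂) - 2 * ((T * F₁) * (T * F₂) * (T * F₁)) +
      (T * F₂) * (T * F₁) ^ 2 = 0 ∧
    (T * F₂) ^ 2 * (T * F₁) - 2 * ((T * F₂) * (T * F₁) * (T * F₂)) +
      (T * F₁) * (T * F₂) ^ 2 = 0 := by
  refine ⟨lie_T_mul_F₂_T_mul_F₁, sq_mul_sub_two_mul_add ?_, sq_mul_sub_two_mul_add ?_⟩
  · rw [lie_T_mul_F₂_T_mul_F₁]
    exact commute_T_mul_F₁_bracket
  · rw [← neg_sub, lie_T_mul_F₂_T_mul_F₁]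
    exact commute_T_mul_F₂_bracket.neg_right
end
end
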